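/- Let N ≥ 2, 1 < p < N, p < q < ∞, p* := Np/(N−p), and a : ℤ^N → [0,∞). Let 1 ≤ r < ∞ satisfy 1/r + 1/p* ≥ 1 and let f : ℤ^N → ℝ satisfy Σ_{x∈ℤ^N} |f(x)|^r < ∞. Then there exists u : ℤ^N → ℝ with Σ_{x∈ℤ^N} |u(x)|^{p*} < ∞ and ρ(∇u) < ∞ such that L u(x₀) = f(x₀) for every x₀ ∈ ℤ^N. -/

import Mathlib

open Filter Topology
open scoped ENNReal Classical

noncomputable section

abbrev ZN (N : ℕ) := Fin N → ℤ

def adj {N : ℕ} (x y : ZN N) : Prop := (∑ i, (x i - y i).natAbs) = 1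

def eInt {N : ℕ} (g : ZN N → ZN N → ℝ) : ℝ≥0∞ :=
  (∑' e : ZN N × ZN N, if adj e.1 e.2 then ENNReal.ofReal (g e.1 e.2) else 0) / 2

def grad {N : ℕ} (u : ZN N → ℝ) (x y : ZN N) : ℝ := u y - u x

def energy {N : ℕ} (p q : ℝ) (a u : ZN N → ℝ) : ℝ≥0∞ :=
  eInt (fun x y => (1 / p) * |grad u x y| ^ p + (a x / q) * |grad u x y| ^ q)

def gradModular {N : ℕ} (p q : ℝ) (a u : ZN N → ℝ) : ℝ≥0∞ :=
  eInt (fun x y => |grad u x y| ^ p + a x * |grad u x y| ^ q)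

def vsum {N : ℕ} (r : ℝ) (u : ZN N → ℝ) : ℝ≥0∞ :=
  ∑' x : ZN N, ENNReal.ofReal (|u x| ^ r)

def Slevel {N : ℕ} (p q : ℝ) (a : ZN N → ℝ) (r t : ℝ) : ℝ≥0∞ :=
  sInf { c : ℝ≥0∞ | ∃ u : ZN N → ℝ, (Function.support u).Finite ∧
      vsum r u = ENNReal.ofReal (r * t) ∧ energy p q a u = c }

def Lop {N : ℕ} (p q : ℝ) (a u : ZN N → ℝ) (x₀ : ZN N) : ℝ :=
  -(∑' y : ZN N, if adj x₀ y then |u y - u x₀| ^ (p - 2) * (u y - u x₀) else 0)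
    - ∑' y : ZN N, if adj x₀ y then
        ((a x₀ + a y) / 2) * (|u y - u x₀| ^ (q - 2) * (u y - u x₀)) else 0

section Neighbours

/-- The `2N` unit vectors of `ℤ^N`. -/
def dirs (N : ℕ) : Finset (ZN N) :=
  (Fintype.piFinset fun _ => Finset.Icc (-1) 1).filter fun e => ∑ i, (e i).natAbs = 1

variable {N : ℕ}

lemma mem_dirs {e : ZN N} : e ∈ dirs N ↔ ∑ i, (e i).natAbs = 1 := by
  simp only [dirs, Finset.mem_filter, Fintype.mem_piFinset, Finset.mem_Icc, and_iff_right_iff_imp]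
  intro h i
  have := Finset.single_le_sum (f := fun i => (e i).natAbs) (fun _ _ => Nat.zero_le _)
    (Finset.mem_univ i)
  simp only [h] at this
  omega

lemma adj_add_right {x e : ZN N} : adj x (x + e) ↔ e ∈ dirs N := by
  simp [adj, mem_dirs]

lemma neg_mem_dirs {e : ZN N} (he : e ∈ dirs N) : -e ∈ dirs N := by
  simpa [mem_dirs] using he

lemma single_mem_dirs (i : Fin N) : Pi.single i 1 ∈ dirs N := by
  rw [mem_dirs, Finset.sum_eq_single i]
  · simp
  · intro j _ hj
    simp [hj]
  · simp

lemma tsum_adj {M : Type*} [AddCommMonoid M] [TopologicalSpace M] (x : ZN N) (h : ZN N → M) :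
    (∑' y, if adj x y then h y else 0) = ∑ e ∈ dirs N, h (x + e) := by
  rw [tsum_eq_sum (s := (dirs N).map (addLeftEmbedding x))]
  · rw [Finset.sum_map]
    exact Finset.sum_congr rfl fun e he => if_pos (adj_add_right.2 he)
  · intro y hy
    refine if_neg fun hxy => hy ?_
    rw [Finset.mem_map]
    refine ⟨y - x, (adj_add_right (x := x)).1 (by simpa using hxy), by simp⟩

end Neighbours

section Sobolev

open MeasureTheory

lemma pi_count_eq_count (N : ℕ) :
    Measure.pi (fun _ : Fin N => (Measure.count : Measure ℤ)) = Measure.count := by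
  refine Measure.ext_of_singleton fun x => ?_
  rw [Measure.pi_singleton]
  simp

/-- The `ℓ^p` energy `∑ₓ ∑ₑ |u(x+e) - u(x)|^p`. -/
def dirichletSum {N : ℕ} (p : ℝ) (u : ZN N → ℝ) : ℝ≥0∞ :=
  ∑' x, ∑ e ∈ dirs N, ENNReal.ofReal (|u (x + e) - u x| ^ p)

variable {N : ℕ}

lemma ofReal_abs_le_tsum_grad {g : ZN N → ℝ} (hg : (Function.support g).Finite) (x : ZN N)
    (i : Fin N) :
    ENNReal.ofReal |g x| ≤ ∑' k : ℤ, ∑ e ∈ dirs N,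
      ENNReal.ofReal |g (Function.update x i k + e) - g (Function.update x i k)| := by
  obtain ⟨M, hM⟩ : ∃ M : ℕ, g (Function.update x i (x i + M)) = 0 := by
    by_contra! h
    refine Set.infinite_of_injective_forall_mem (f := fun m : ℕ => Function.update x i (x i + m))
      ?_ h hg
    intro m n hmn
    have := congr_fun hmn i
    simpa using this
  have key : ∀ m : ℕ, ENNReal.ofReal |g x| ≤
      ENNReal.ofReal |g (Function.update x i (x i + m))| +
      ∑ j ∈ Finset.range m, ∑ e ∈ dirs N, ENNReal.ofReal
        |g (Function.update x i (x i + j) + e) - g (Function.update x i (x i + j))| := by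
    intro m
    induction m with
    | zero => simp
    | succ m ih =>
      refine ih.trans ?_
      rw [Finset.sum_range_succ, add_comm (∑ j ∈ Finset.range m, _), ← add_assoc]
      gcongr
      have h1 : Function.update x i (x i + ((m + 1 : ℕ) : ℤ))
          = Function.update x i (x i + (m : ℤ)) + Pi.single i 1 := by
        ext j
        by_cases hj : j = i
        · subst hj
          simp [add_assoc]
        · simp [hj]
      refine le_trans ?_ (add_le_add_right (Finset.single_le_sum (fun _ _ => zero_le)
        (single_mem_dirs i)) _)
      rw [h1, ← ENNReal.ofReal_add (abs_nonneg _) (abs_nonneg _)]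
      refine ENNReal.ofReal_le_ofReal ?_
      set a := g (Function.update x i (x i + (m : ℤ)) + Pi.single i 1)
      set b := g (Function.update x i (x i + (m : ℤ)))
      have := abs_sub_abs_le_abs_sub b a
      rw [abs_sub_comm] at this
      linarith
  refine (key M).trans ?_
  rw [hM, abs_zero, ENNReal.ofReal_zero, zero_add]
  have hinj : Function.Injective fun j : ℕ => x i + (j : ℤ) := by
    intro m n h
    simpa using h
  exact (ENNReal.sum_le_tsum _).trans (ENNReal.tsum_comp_le_tsum_of_injective hinj
    fun k => ∑ e ∈ dirs N,
      ENNReal.ofReal |g (Function.update x i k + e) - g (Function.update x i k)|)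

lemma tsum_rpow_le_dirichletSum_one (hN : 2 ≤ N) {g : ZN N → ℝ}
    (hg : (Function.support g).Finite) :
    ∑' x, ENNReal.ofReal |g x| ^ ((N : ℝ) / (N - 1)) ≤
      (dirichletSum 1 g) ^ ((N : ℝ) / (N - 1)) := by
  have hN' : (2 : ℝ) ≤ N := by exact_mod_cast hN
  have hN1 : (0 : ℝ) < N - 1 := by linarith
  set F : ZN N → ℝ≥0∞ := fun x => ∑ e ∈ dirs N, ENNReal.ofReal |g (x + e) - g x| with hF
  have hconj : Real.HolderConjugate (Fintype.card (Fin N)) ((N : ℝ) / (N - 1)) := by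
    rw [Fintype.card_fin, Real.holderConjugate_iff]
    refine ⟨by linarith, ?_⟩
    field_simp
    ring
  have := lintegral_prod_lintegral_pow_le (fun _ : Fin N => (Measure.count : Measure ℤ)) hconj
    (f := F) (measurable_of_countable F)
  rw [pi_count_eq_count, lintegral_count, lintegral_count, Fintype.card_fin] at this
  have hd : dirichletSum 1 g = ∑' x, F x := by simp [dirichletSum, hF]
  rw [hd]
  refine le_trans (ENNReal.tsum_le_tsum fun x => ?_) this
  have h1 : ENNReal.ofReal |g x| ^ ((N : ℝ) / (N - 1)) =
      ∏ _i : Fin N, ENNReal.ofReal |g x| ^ (1 / ((N : ℝ) - 1)) := by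
    rw [Finset.prod_const, Finset.card_univ, Fintype.card_fin, ← ENNReal.rpow_natCast,
      ← ENNReal.rpow_mul]
    congr 1
    ring
  rw [h1]
  refine Finset.prod_le_prod' fun i _ => ENNReal.rpow_le_rpow ?_ (by positivity)
  rw [lintegral_count]
  exact ofReal_abs_le_tsum_grad hg x i

lemma rpow_sub_rpow_le {s t c : ℝ} (hs : 0 ≤ s) (ht : 0 ≤ t) (hc : 1 ≤ c) :
    s ^ c - t ^ c ≤ c * s ^ (c - 1) * |s - t| := by
  rcases le_total s t with h | h
  · have : s ^ c ≤ t ^ c := Real.rpow_le_rpow hs h (by linarith)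
    have : 0 ≤ c * s ^ (c - 1) * |s - t| := by positivity
    linarith
  · rcases hs.eq_or_lt with rfl | hs'
    · obtain rfl : t = 0 := le_antisymm h ht
      simp
    · have hb := one_add_mul_self_le_rpow_one_add (s := t / s - 1)
        (by linarith [div_nonneg ht hs]) hc
      rw [add_sub_cancel, Real.div_rpow ht hs, le_div_iff₀ (by positivity)] at hb
      rw [abs_of_nonneg (by linarith), Real.rpow_sub_one hs'.ne']
      have : (1 + c * (t / s - 1)) * s ^ c = s ^ c - c * (s ^ c / s) * (s - t) := by
        field_simp
        ring
      linarith

lemma abs_rpow_abs_sub_le (a b : ℝ) {c : ℝ} (hc : 1 ≤ c) :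
    abs (|a| ^ c - |b| ^ c) ≤ c * ((|a| ^ (c - 1) + |b| ^ (c - 1)) * |a - b|) := by
  have h1 := rpow_sub_rpow_le (abs_nonneg a) (abs_nonneg b) hc
  have h2 := rpow_sub_rpow_le (abs_nonneg b) (abs_nonneg a) hc
  rw [abs_sub_comm] at h2
  have h3 := abs_abs_sub_abs_le a b
  have ha : 0 ≤ c * |a| ^ (c - 1) := by positivity
  have hb : 0 ≤ c * |b| ^ (c - 1) := by positivity
  have h4 := mul_le_mul_of_nonneg_left h3 ha
  have h5 := mul_le_mul_of_nonneg_left h3 hb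
  have h6 := mul_nonneg ha (abs_nonneg (a - b))
  have h7 := mul_nonneg hb (abs_nonneg (a - b))
  rw [abs_le]
  constructor <;> nlinarith

lemma tsum_mul_le_Lp_mul_Lq {ι : Type*} (f g : ι → ℝ≥0∞) {p q : ℝ}
    (hpq : p.HolderConjugate q) :
    ∑' i, f i * g i ≤ (∑' i, f i ^ p) ^ (1 / p) * (∑' i, g i ^ q) ^ (1 / q) := by
  rw [ENNReal.tsum_eq_iSup_sum]
  refine iSup_le fun s => (ENNReal.inner_le_Lp_mul_Lq s f g hpq).trans ?_
  have hp := hpq.one_div_nonneg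
  have hq := hpq.symm.one_div_nonneg
  gcongr <;> exact ENNReal.sum_le_tsum s

/-- Discrete Gagliardo–Nirenberg–Sobolev inequality. -/
lemma exists_sobolev_const (hN : 2 ≤ N) {p : ℝ} (hp : 1 < p) (hpN : p < N) :
    ∃ K : ℝ, 0 ≤ K ∧ ∀ u : ZN N → ℝ, (Function.support u).Finite →
      vsum (N * p / (N - p)) u ^ (1 / (N * p / (N - p) : ℝ)) ≤
        ENNReal.ofReal K * dirichletSum p u ^ (1 / p) := by
  have hN' : (2 : ℝ) ≤ N := by exact_mod_cast hN
  have hNp : 0 < (N : ℝ) - p := by linarith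
  have hN1 : (0 : ℝ) < N - 1 := by linarith
  set c : ℝ := p * (N - 1) / (N - p) with hc
  set s : ℝ := N * p / (N - p) with hs
  have hs0 : 0 < s := by positivity
  have hc1 : 1 ≤ c := by
    rw [hc, le_div_iff₀ hNp]
    nlinarith
  have hcs : c * ((N : ℝ) / (N - 1)) = s := by
    rw [hc, hs]
    field_simp
  have hpp := Real.HolderConjugate.conjExponent hp
  set p' := p.conjExponent with hp'
  have hp'eq : p' = p / (p - 1) := rfl
  have hp1 : 0 < p - 1 := by linarith
  have hcp : (c - 1) * p' = s := by
    rw [hc, hs, hp'eq]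
    field_simp
    ring
  refine ⟨c * (2 * (dirs N).card), by positivity, fun u hu => ?_⟩
  set S := vsum s u with hS
  set G := dirichletSum p u with hG
  have hSS : S = ∑' x, ENNReal.ofReal |u x| ^ s := by
    rw [hS, vsum]
    exact tsum_congr fun x => (ENNReal.ofReal_rpow_of_nonneg (abs_nonneg _) hs0.le).symm
  have hSfin : S ≠ ⊤ := by
    rw [hSS, tsum_eq_sum (s := hu.toFinset)]
    · exact ENNReal.sum_ne_top.2 fun x _ =>
        ENNReal.rpow_ne_top_of_nonneg hs0.le ENNReal.ofReal_ne_top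
    · intro x hx
      simp only [Set.Finite.mem_toFinset, Function.mem_support, not_not] at hx
      simp [hx, hs0]
  have hshift : ∀ e : ZN N, ∑' x, ENNReal.ofReal |u (x + e)| ^ s = S := fun e => by
    rw [hSS]
    exact (Equiv.addRight e).tsum_eq fun x => ENNReal.ofReal |u x| ^ s
  have hpart : ∀ e ∈ dirs N, ∑' x, ENNReal.ofReal |u (x + e) - u x| ^ p ≤ G := fun e he => by
    rw [hG, dirichletSum]
    refine ENNReal.tsum_le_tsum fun x => ?_
    rw [ENNReal.ofReal_rpow_of_nonneg (abs_nonneg _) (by linarith)]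
    exact Finset.single_le_sum (f := fun e => ENNReal.ofReal (|u (x + e) - u x| ^ p))
      (fun _ _ => zero_le) he
  have hold : ∀ e ∈ dirs N, ∀ e' : ZN N,
      ∑' x, ENNReal.ofReal |u (x + e')| ^ (c - 1) * ENNReal.ofReal |u (x + e) - u x| ≤
        S ^ (1 / p') * G ^ (1 / p) := fun e he e' => by
    refine (tsum_mul_le_Lp_mul_Lq _ _ hpp.symm).trans ?_
    simp_rw [← ENNReal.rpow_mul, hcp, hshift]
    have := hpp.one_div_nonneg
    gcongr
    exact hpart e he
  set g : ZN N → ℝ := fun x => |u x| ^ c with hg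
  have hgfin : (Function.support g).Finite := by
    refine hu.subset fun x hx => ?_
    contrapose! hx
    simp only [Function.mem_support, not_not] at hx ⊢
    simp [hg, hx, (by linarith : c ≠ 0)]
  have hsob := tsum_rpow_le_dirichletSum_one hN hgfin
  have hgs : ∑' x, ENNReal.ofReal |g x| ^ ((N : ℝ) / (N - 1)) = S := by
    rw [hSS]
    refine tsum_congr fun x => ?_
    rw [hg, abs_of_nonneg (by positivity), ← ENNReal.ofReal_rpow_of_nonneg (abs_nonneg _)
      (by linarith), ← ENNReal.rpow_mul, hcs]
  have hD : dirichletSum 1 g ≤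
      ENNReal.ofReal (c * (2 * (dirs N).card)) * (S ^ (1 / p') * G ^ (1 / p)) := by
    have hpt : ∀ x e : ZN N, ENNReal.ofReal (|g (x + e) - g x| ^ (1 : ℝ)) ≤
        ENNReal.ofReal c *
          (ENNReal.ofReal |u (x + e)| ^ (c - 1) * ENNReal.ofReal |u (x + e) - u x| +
          ENNReal.ofReal |u (x + 0)| ^ (c - 1) * ENNReal.ofReal |u (x + e) - u x|) := by
      intro x e
      rw [Real.rpow_one, ← add_mul, ENNReal.ofReal_rpow_of_nonneg (abs_nonneg _) (by linarith),
        ENNReal.ofReal_rpow_of_nonneg (abs_nonneg _) (by linarith),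
        ← ENNReal.ofReal_add (by positivity) (by positivity),
        ← ENNReal.ofReal_mul (by positivity), ← ENNReal.ofReal_mul (by positivity), add_zero]
      exact ENNReal.ofReal_le_ofReal (abs_rpow_abs_sub_le _ _ hc1)
    calc dirichletSum 1 g
        ≤ ∑' x, ∑ e ∈ dirs N, ENNReal.ofReal c *
          (ENNReal.ofReal |u (x + e)| ^ (c - 1) * ENNReal.ofReal |u (x + e) - u x| +
          ENNReal.ofReal |u (x + 0)| ^ (c - 1) * ENNReal.ofReal |u (x + e) - u x|) :=
          ENNReal.tsum_le_tsum fun x => Finset.sum_le_sum fun e _ => hpt x e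
      _ = ∑ e ∈ dirs N, ENNReal.ofReal c *
          (∑' x, ENNReal.ofReal |u (x + e)| ^ (c - 1) * ENNReal.ofReal |u (x + e) - u x| +
          ∑' x, ENNReal.ofReal |u (x + 0)| ^ (c - 1) * ENNReal.ofReal |u (x + e) - u x|) := by
          rw [Summable.tsum_finsetSum fun _ _ => ENNReal.summable]
          simp_rw [ENNReal.tsum_mul_left, ENNReal.tsum_add]
      _ ≤ ∑ e ∈ dirs N, ENNReal.ofReal c *
          (S ^ (1 / p') * G ^ (1 / p) + S ^ (1 / p') * G ^ (1 / p)) := by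
          gcongr with e he
          · exact hold e he e
          · exact hold e he 0
      _ = _ := by
          rw [Finset.sum_const, ENNReal.ofReal_mul (by positivity),
            ENNReal.ofReal_mul (by positivity), nsmul_eq_mul, ENNReal.ofReal_natCast,
            ENNReal.ofReal_ofNat]
          ring
  rw [hgs] at hsob
  have hNinv : (0 : ℝ) < N / (N - 1) := by positivity
  have h1 : S ^ (((N : ℝ) - 1) / N) ≤ dirichletSum 1 g := by
    rw [← ENNReal.rpow_le_rpow_iff hNinv, ← ENNReal.rpow_mul]
    convert hsob using 1
    rw [show ((N : ℝ) - 1) / N * (N / (N - 1)) = 1 by field_simp, ENNReal.rpow_one]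
  have h2 := h1.trans hD
  rcases eq_or_ne S 0 with h0 | h0
  · rw [h0, ENNReal.zero_rpow_of_pos (by positivity)]
    exact zero_le
  · have hexp : ((N : ℝ) - 1) / N = 1 / p' + 1 / s := by
      rw [hs, hp'eq]
      field_simp
      ring
    rw [hexp, ENNReal.rpow_add _ _ h0 hSfin, mul_left_comm] at h2
    refine (ENNReal.mul_le_mul_iff_right ?_ ?_).1 h2
    · simp [ENNReal.rpow_eq_zero_iff, h0, hSfin]
    · exact ENNReal.rpow_ne_top_of_nonneg hpp.symm.one_div_nonneg hSfin

end Sobolev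

section LocalEnergy

variable {N : ℕ}

lemma continuous_abs_rpow_mul_self {s : ℝ} (hs : 1 < s) :
    Continuous fun t : ℝ => |t| ^ (s - 2) * t := by
  have h := (contDiff_norm_rpow (E := ℝ) hs).continuous_deriv le_rfl
  have h' : deriv (fun t : ℝ => ‖t‖ ^ s) = fun t => s * |t| ^ (s - 2) * t := by
    ext t
    exact (hasDerivAt_norm_rpow t hs).deriv
  rw [h'] at h
  convert h.const_mul s⁻¹ using 2 with t
  field_simp

lemma Lop_eq_sum_dirs (p q : ℝ) (a u : ZN N → ℝ) (x₀ : ZN N) :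
    Lop p q a u x₀ =
      -(∑ e ∈ dirs N, |u (x₀ + e) - u x₀| ^ (p - 2) * (u (x₀ + e) - u x₀)) -
        ∑ e ∈ dirs N, ((a x₀ + a (x₀ + e)) / 2) *
          (|u (x₀ + e) - u x₀| ^ (q - 2) * (u (x₀ + e) - u x₀)) := by
  rw [Lop, tsum_adj x₀ fun y => |u y - u x₀| ^ (p - 2) * (u y - u x₀),
    tsum_adj x₀ fun y => ((a x₀ + a y) / 2) * (|u y - u x₀| ^ (q - 2) * (u y - u x₀))]

lemma continuous_Lop {p q : ℝ} (hp : 1 < p) (hq : 1 < q) (a : ZN N → ℝ) (x₀ : ZN N) :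
    Continuous fun u : ZN N → ℝ => Lop p q a u x₀ := by
  simp_rw [Lop_eq_sum_dirs]
  have hd : ∀ e, Continuous fun u : ZN N → ℝ => u (x₀ + e) - u x₀ := fun e => by fun_prop
  refine (continuous_finsetSum _ fun e _ => ?_).neg.sub (continuous_finsetSum _ fun e _ => ?_)
  · exact (continuous_abs_rpow_mul_self hp).comp (hd e)
  · exact continuous_const.mul ((continuous_abs_rpow_mul_self hq).comp (hd e))

/-- `B` together with all its lattice neighbours. -/
def thicken (B : Finset (ZN N)) : Finset (ZN N) :=
  B ∪ (B ×ˢ dirs N).image fun z => z.1 - z.2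

lemma subset_thicken (B : Finset (ZN N)) : B ⊆ thicken B := Finset.subset_union_left

lemma sub_mem_thicken {B : Finset (ZN N)} {x e : ZN N} (hx : x ∈ B) (he : e ∈ dirs N) :
    x - e ∈ thicken B :=
  Finset.mem_union_right _ (Finset.mem_image.2 ⟨(x, e), Finset.mem_product.2 ⟨hx, he⟩, rfl⟩)

lemma sub_eq_zero_of_notMem_thicken {B : Finset (ZN N)} {u : ZN N → ℝ}
    (hu : ∀ x ∉ B, u x = 0) {x e : ZN N} (hx : x ∉ thicken B) (he : e ∈ dirs N) :
    u (x + e) - u x = 0 := by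
  rw [hu x fun h => hx (subset_thicken B h), hu (x + e) fun h => hx ?_, sub_zero]
  simpa using sub_mem_thicken h he

/-- The functional whose critical points on `{u | u = 0 off B}` solve `L u = f` in `B`. -/
def localFunctional (p q : ℝ) (a f : ZN N → ℝ) (B : Finset (ZN N)) (u : ZN N → ℝ) : ℝ :=
  (1 / 2) * ∑ x ∈ thicken B, ∑ e ∈ dirs N,
    ((1 / p) * |u (x + e) - u x| ^ p + (a x / q) * |u (x + e) - u x| ^ q) - ∑ x ∈ B, f x * u x

lemma continuous_localFunctional {p q : ℝ} (hp : 0 ≤ p) (hq : 0 ≤ q) (a f : ZN N → ℝ)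
    (B : Finset (ZN N)) : Continuous (localFunctional p q a f B) := by
  have hd : ∀ x e, Continuous fun u : ZN N → ℝ => |u (x + e) - u x| := fun x e => by fun_prop
  unfold localFunctional
  refine (continuous_const.mul (continuous_finsetSum _ fun x _ => continuous_finsetSum _
    fun e _ => ?_)).sub (by fun_prop)
  exact (continuous_const.mul ((hd x e).rpow_const fun _ => Or.inr hp)).add
    (continuous_const.mul ((hd x e).rpow_const fun _ => Or.inr hq))

lemma hasDerivAt_localFunctional {p q : ℝ} (hp : 1 < p) (hq : 1 < q) (a f : ZN N → ℝ)
    (B : Finset (ZN N)) (u v : ZN N → ℝ) :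
    HasDerivAt (fun t : ℝ => localFunctional p q a f B (u + t • v))
      ((1 / 2) * ∑ x ∈ thicken B, ∑ e ∈ dirs N,
        (|u (x + e) - u x| ^ (p - 2) * (u (x + e) - u x) +
          a x * (|u (x + e) - u x| ^ (q - 2) * (u (x + e) - u x))) * (v (x + e) - v x) -
        ∑ x ∈ B, f x * v x) 0 := by
  unfold localFunctional
  have hline : ∀ x, HasDerivAt (fun t : ℝ => (u + t • v) x) (v x) 0 := fun x => by
    simpa using ((hasDerivAt_id (0 : ℝ)).mul_const (v x)).const_add (u x)
  refine ((HasDerivAt.fun_sum fun x _ => HasDerivAt.fun_sum fun e _ => ?_).const_mul _).sub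
    (HasDerivAt.fun_sum fun x _ => (hline x).const_mul _)
  have hd : HasDerivAt (fun t : ℝ => (u + t • v) (x + e) - (u + t • v) x) (v (x + e) - v x) 0 :=
    (hline _).sub (hline _)
  have h0 : (u + (0 : ℝ) • v) (x + e) - (u + (0 : ℝ) • v) x = u (x + e) - u x := by simp
  have hpow : ∀ s : ℝ, 1 < s → HasDerivAt
      (fun t : ℝ => |(u + t • v) (x + e) - (u + t • v) x| ^ s)
      (s * |u (x + e) - u x| ^ (s - 2) * (u (x + e) - u x) * (v (x + e) - v x)) 0 := by
    intro s hs
    have := hasDerivAt_abs_rpow ((u + (0 : ℝ) • v) (x + e) - (u + (0 : ℝ) • v) x) hs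
    have h := this.comp (0 : ℝ) hd
    rw [h0] at h
    exact h
  refine (((hpow p hp).const_mul (1 / p)).add ((hpow q hq).const_mul (a x / q))).congr_deriv ?_
  field_simp

lemma sum_mul_single_sub {B : Finset (ZN N)} {x₀ : ZN N} (hx₀ : x₀ ∈ B) (ψ : ZN N → ZN N → ℝ) :
    ∑ x ∈ thicken B, ∑ e ∈ dirs N,
      ψ x e * ((Pi.single x₀ 1 : ZN N → ℝ) (x + e) - (Pi.single x₀ 1 : ZN N → ℝ) x) =
        ∑ e ∈ dirs N, (ψ (x₀ + e) (-e) - ψ x₀ e) := by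
  rw [Finset.sum_comm]
  have h1 : ∀ e ∈ dirs N, ∑ x ∈ thicken B,
      ψ x e * ((Pi.single x₀ 1 : ZN N → ℝ) (x + e) - (Pi.single x₀ 1 : ZN N → ℝ) x) =
        ψ (x₀ - e) e - ψ x₀ e := by
    intro e he
    simp_rw [mul_sub, Pi.single_apply, ← eq_sub_iff_add_eq]
    rw [Finset.sum_sub_distrib]
    simp [sub_mem_thicken hx₀ he, subset_thicken B hx₀]
  rw [Finset.sum_congr rfl h1, Finset.sum_sub_distrib, Finset.sum_sub_distrib]
  congr 1
  refine Finset.sum_nbij' (fun e => -e) (fun e => -e) (fun e he => neg_mem_dirs he)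
    (fun e he => neg_mem_dirs he) ?_ ?_ ?_ <;> simp [sub_eq_add_neg]

lemma Lop_eq_of_isLocalMin {p q : ℝ} (hp : 1 < p) (hq : 1 < q) {a f : ZN N → ℝ}
    {B : Finset (ZN N)} {u : ZN N → ℝ} {x₀ : ZN N} (hx₀ : x₀ ∈ B)
    (hmin : IsLocalMin
      (fun t : ℝ => localFunctional p q a f B (u + t • (Pi.single x₀ 1 : ZN N → ℝ))) 0) :
    Lop p q a u x₀ = f x₀ := by
  have h := hmin.hasDerivAt_eq_zero (hasDerivAt_localFunctional hp hq a f B u (Pi.single x₀ 1))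
  rw [sum_mul_single_sub hx₀ fun x e => |u (x + e) - u x| ^ (p - 2) * (u (x + e) - u x) +
          a x * (|u (x + e) - u x| ^ (q - 2) * (u (x + e) - u x))] at h
  have hf : ∑ x ∈ B, f x * (Pi.single x₀ 1 : ZN N → ℝ) x = f x₀ := by
    simp [Pi.single_apply, hx₀]
  rw [hf] at h
  rw [Lop_eq_sum_dirs, ← sub_eq_zero, ← h, Finset.mul_sum, ← Finset.sum_neg_distrib,
    ← Finset.sum_sub_distrib]
  congr 1
  refine Finset.sum_congr rfl fun e _ => ?_
  simp only [add_neg_cancel_right]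
  rw [← neg_sub (u (x₀ + e)) (u x₀), abs_neg]
  ring

end LocalEnergy

section APriori

variable {N : ℕ}

lemma vsum_eq_ofReal {s : ℝ} (hs : 0 < s) {B : Finset (ZN N)} {u : ZN N → ℝ}
    (hu : ∀ x ∉ B, u x = 0) : vsum s u = ENNReal.ofReal (∑ x ∈ B, |u x| ^ s) := by
  rw [vsum, tsum_eq_sum (s := B), ENNReal.ofReal_sum_of_nonneg fun _ _ => by positivity]
  intro x hx
  simp [hu x hx, hs.ne']

lemma dirichletSum_eq_ofReal {p : ℝ} (hp : 0 < p) {B : Finset (ZN N)} {u : ZN N → ℝ}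
    (hu : ∀ x ∉ B, u x = 0) :
    dirichletSum p u =
      ENNReal.ofReal (∑ x ∈ thicken B, ∑ e ∈ dirs N, |u (x + e) - u x| ^ p) := by
  rw [dirichletSum, tsum_eq_sum (s := thicken B),
    ENNReal.ofReal_sum_of_nonneg fun _ _ => by positivity]
  · refine Finset.sum_congr rfl fun x _ => ?_
    rw [ENNReal.ofReal_sum_of_nonneg fun _ _ => by positivity]
  · intro x hx
    refine Finset.sum_eq_zero fun e he => ?_
    simp [sub_eq_zero_of_notMem_thicken hu hx he, hp.ne']

lemma gradModular_eq_ofReal {p q : ℝ} (hp : 0 < p) (hq : 0 < q) {a : ZN N → ℝ}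
    (ha : ∀ x, 0 ≤ a x) {B : Finset (ZN N)} {u : ZN N → ℝ} (hu : ∀ x ∉ B, u x = 0) :
    gradModular p q a u = ENNReal.ofReal ((1 / 2) * ∑ x ∈ thicken B, ∑ e ∈ dirs N,
      (|u (x + e) - u x| ^ p + a x * |u (x + e) - u x| ^ q)) := by
  have hnn : ∀ x e : ZN N, 0 ≤ |u (x + e) - u x| ^ p + a x * |u (x + e) - u x| ^ q := fun x e => by
    have := ha x
    positivity
  rw [gradModular, eInt, ENNReal.tsum_prod', one_div, inv_mul_eq_div,
    ENNReal.ofReal_div_of_pos two_pos, ENNReal.ofReal_ofNat]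
  congr 1
  simp_rw [tsum_adj _ fun y => ENNReal.ofReal (|grad u _ y| ^ p + a _ * |grad u _ y| ^ q), grad]
  rw [tsum_eq_sum (s := thicken B),
    ENNReal.ofReal_sum_of_nonneg fun x _ => Finset.sum_nonneg fun e _ => hnn x e]
  · refine Finset.sum_congr rfl fun x _ => ?_
    rw [ENNReal.ofReal_sum_of_nonneg fun e _ => hnn x e]
  · intro x hx
    refine Finset.sum_eq_zero fun e he => ?_
    simp [sub_eq_zero_of_notMem_thicken hu hx he, hp.ne', hq.ne']

lemma exists_forall_Lp_norm_le {r s : ℝ} (hr : 0 < r) (hrs : r ≤ s) {f : ZN N → ℝ}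
    (hf : vsum r f < ⊤) :
    ∃ C : ℝ, 0 ≤ C ∧ ∀ B : Finset (ZN N), (∑ x ∈ B, |f x| ^ s) ^ (1 / s) ≤ C := by
  set A := (vsum r f).toReal with hA
  have hA0 : 0 ≤ A := ENNReal.toReal_nonneg
  have hs : 0 < s := hr.trans_le hrs
  have hB : ∀ B : Finset (ZN N), ∑ x ∈ B, |f x| ^ r ≤ A := by
    intro B
    rw [← ENNReal.ofReal_le_ofReal_iff hA0, hA, ENNReal.ofReal_toReal hf.ne,
      ENNReal.ofReal_sum_of_nonneg fun _ _ => by positivity]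
    exact ENNReal.sum_le_tsum B
  have hpt : ∀ x, |f x| ≤ A ^ (1 / r) := by
    intro x
    have := hB {x}
    rw [Finset.sum_singleton] at this
    rw [one_div]
    exact (Real.le_rpow_inv_iff_of_pos (abs_nonneg _) hA0 hr).2 this
  refine ⟨(A * (A ^ (1 / r)) ^ (s - r)) ^ (1 / s), by positivity, fun B => ?_⟩
  refine Real.rpow_le_rpow (by positivity) ?_ (by positivity)
  calc ∑ x ∈ B, |f x| ^ s ≤ ∑ x ∈ B, |f x| ^ r * (A ^ (1 / r)) ^ (s - r) := by
        refine Finset.sum_le_sum fun x _ => ?_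
        rw [show s = r + (s - r) by ring,
          Real.rpow_add_of_nonneg (abs_nonneg _) hr.le (by linarith),
          add_sub_cancel]
        gcongr
        exact hpt x
    _ ≤ _ := by
        rw [← Finset.sum_mul]
        gcongr
        exact hB B

lemma le_rpow_of_le_mul_rpow {A Q p : ℝ} (hp : 1 < p) (hQ : 0 ≤ Q) (hA : 0 ≤ A)
    (h : Q ≤ A * Q ^ (1 / p)) : Q ≤ A ^ (p / (p - 1)) := by
  rcases hQ.eq_or_lt with rfl | hQ
  · positivity
  have hp1 : 0 < p - 1 := by linarith
  have h1 : Q ^ ((p - 1) / p) ≤ A := by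
    rw [show (p - 1) / p = 1 - 1 / p by field_simp, Real.rpow_sub hQ, Real.rpow_one]
    exact (div_le_iff₀ (by positivity)).2 h
  have h2 := Real.rpow_le_rpow (by positivity) h1 (show 0 ≤ p / (p - 1) by positivity)
  rwa [← Real.rpow_mul hQ.le, show (p - 1) / p * (p / (p - 1)) = 1 by field_simp,
    Real.rpow_one] at h2

lemma exists_bound_of_localFunctional_nonpos (hN : 2 ≤ N) {p q : ℝ} (hp : 1 < p) (hpN : p < N)
    (hpq : p < q) {a : ZN N → ℝ} (ha : ∀ x, 0 ≤ a x) {s s' : ℝ} (hs : s = N * p / (N - p))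
    (hss' : s.HolderConjugate s') {f : ZN N → ℝ} {C : ℝ} (hC : 0 ≤ C)
    (hf : ∀ B : Finset (ZN N), (∑ x ∈ B, |f x| ^ s') ^ (1 / s') ≤ C) :
    ∃ R : ℝ, 0 ≤ R ∧ ∀ (B : Finset (ZN N)) (u : ZN N → ℝ), (∀ x ∉ B, u x = 0) →
      localFunctional p q a f B u ≤ 0 →
        vsum s u ≤ ENNReal.ofReal R ∧ gradModular p q a u ≤ ENNReal.ofReal R := by
  obtain ⟨K, hK, hsob⟩ := exists_sobolev_const hN hp hpN
  rw [← hs] at hsob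
  have hp0 : 0 < p := by linarith
  have hq0 : 0 < q := by linarith
  have hs0 : 0 < s := hss'.pos
  set A := q * (C * (K * 2 ^ (1 / p))) with hA
  have hA0 : 0 ≤ A := by positivity
  set M := A ^ (p / (p - 1)) with hM
  have hM0 : 0 ≤ M := by positivity
  refine ⟨max M ((K * (2 * M) ^ (1 / p)) ^ s), le_max_of_le_left hM0, fun B u hu hJ => ?_⟩
  rw [vsum_eq_ofReal hs0 hu, gradModular_eq_ofReal hp0 hq0 ha hu]
  have hsobu := hsob u (B.finite_toSet.subset fun x hx => by
    by_contra h
    exact hx (hu x h))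
  rw [vsum_eq_ofReal hs0 hu, dirichletSum_eq_ofReal hp0 hu] at hsobu
  set V := ∑ x ∈ B, |u x| ^ s
  set G := ∑ x ∈ thicken B, ∑ e ∈ dirs N, |u (x + e) - u x| ^ p
  set Q := (1 / 2) * ∑ x ∈ thicken B, ∑ e ∈ dirs N,
      (|u (x + e) - u x| ^ p + a x * |u (x + e) - u x| ^ q) with hQ
  have hV0 : 0 ≤ V := by positivity
  have hG0 : 0 ≤ G := by positivity
  have hGQ : G ≤ 2 * Q := by
    rw [hQ, ← mul_assoc, mul_one_div_cancel two_ne_zero, one_mul]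
    refine Finset.sum_le_sum fun x _ => Finset.sum_le_sum fun e _ => ?_
    have := ha x
    exact le_add_of_nonneg_right (by positivity)
  have hQ0 : 0 ≤ Q := by linarith
  rw [ENNReal.ofReal_rpow_of_nonneg hV0 (by positivity),
    ENNReal.ofReal_rpow_of_nonneg hG0 (by positivity), ← ENNReal.ofReal_mul hK,
    ENNReal.ofReal_le_ofReal_iff (by positivity)] at hsobu
  have hVQ : V ^ (1 / s) ≤ K * (2 * Q) ^ (1 / p) := by
    refine hsobu.trans ?_
    gcongr
  have hfu : ∑ x ∈ B, f x * u x ≤ C * V ^ (1 / s) := by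
    refine (Real.inner_le_Lp_mul_Lq B f u hss'.symm).trans ?_
    gcongr
    exact hf B
  have hQJ : Q ≤ q * ∑ x ∈ B, f x * u x := by
    have h1 : Q ≤ q * ((1 / 2) * ∑ x ∈ thicken B, ∑ e ∈ dirs N,
        ((1 / p) * |u (x + e) - u x| ^ p + (a x / q) * |u (x + e) - u x| ^ q)) := by
      rw [hQ, mul_left_comm q]
      refine mul_le_mul_of_nonneg_left ?_ one_half_pos.le
      simp_rw [Finset.mul_sum]
      refine Finset.sum_le_sum fun x _ => Finset.sum_le_sum fun e _ => ?_
      have h2 : 1 ≤ q * (1 / p) := by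
        rw [mul_one_div, le_div_iff₀ hp0]
        linarith
      have h3 : 0 ≤ |u (x + e) - u x| ^ p := by positivity
      rw [mul_add, ← mul_assoc, ← mul_assoc, mul_div_cancel₀ (a x) hq0.ne']
      nlinarith
    refine h1.trans (mul_le_mul_of_nonneg_left ?_ hq0.le)
    unfold localFunctional at hJ
    linarith
  have hQA : Q ≤ A * Q ^ (1 / p) := by
    refine hQJ.trans ?_
    rw [hA, mul_assoc, mul_assoc, mul_assoc, ← Real.mul_rpow two_pos.le hQ0]
    gcongr
    refine hfu.trans ?_
    gcongr
  have hQM : Q ≤ M := le_rpow_of_le_mul_rpow hp hQ0 hA0 hQA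
  refine ⟨ENNReal.ofReal_le_ofReal (le_max_of_le_right ?_),
    ENNReal.ofReal_le_ofReal (le_max_of_le_left hQM)⟩
  have h4 : V ^ (1 / s) ≤ K * (2 * M) ^ (1 / p) := by
    refine hVQ.trans ?_
    gcongr
  rw [one_div] at h4
  exact (Real.rpow_inv_le_iff_of_pos hV0 (by positivity) hs0).1 h4

lemma abs_le_of_vsum_le {s R : ℝ} (hs : 0 < s) (hR : 0 ≤ R) {u : ZN N → ℝ}
    (h : vsum s u ≤ ENNReal.ofReal R) (x : ZN N) : |u x| ≤ R ^ s⁻¹ := by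
  rw [Real.le_rpow_inv_iff_of_pos (abs_nonneg _) hR hs, ← ENNReal.ofReal_le_ofReal_iff hR]
  exact (ENNReal.le_tsum x).trans h

end APriori

section Existence

variable {N : ℕ}

/-- Solvability of the Dirichlet problem in a finite set, given an a priori bound for the functions
with nonpositive energy. -/
lemma exists_solution_on_finset {p q : ℝ} (hp : 1 < p) (hq : 1 < q) {a f : ZN N → ℝ} {M : ℝ}
    (hM : 0 ≤ M) (B : Finset (ZN N))
    (hbound : ∀ u : ZN N → ℝ, (∀ x ∉ B, u x = 0) → localFunctional p q a f B u ≤ 0 →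
      ∀ x, |u x| ≤ M) :
    ∃ u : ZN N → ℝ, (∀ x ∉ B, u x = 0) ∧ localFunctional p q a f B u ≤ 0 ∧
      ∀ x ∈ B, Lop p q a u x = f x := by
  set K : Set (ZN N → ℝ) :=
    Set.pi Set.univ fun x => if x ∈ B then Set.Icc (-(M + 1)) (M + 1) else {0} with hK
  have hKmem : ∀ u : ZN N → ℝ, u ∈ K ↔ (∀ x ∉ B, u x = 0) ∧ ∀ x ∈ B, |u x| ≤ M + 1 := by
    intro u
    simp only [hK, Set.mem_univ_pi]
    constructor
    · intro h
      refine ⟨fun x hx => ?_, fun x hx => ?_⟩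
      · simpa [hx] using h x
      · have := h x
        rw [if_pos hx] at this
        exact abs_le.2 this
    · rintro ⟨h1, h2⟩ x
      by_cases hx : x ∈ B
      · rw [if_pos hx]
        exact abs_le.1 (h2 x hx)
      · simp [hx, h1 x hx]
  have hKc : IsCompact K := isCompact_univ_pi fun x => by
    split_ifs
    exacts [isCompact_Icc, isCompact_singleton]
  have h0K : (0 : ZN N → ℝ) ∈ K := by
    rw [hKmem]
    refine ⟨fun _ _ => rfl, fun _ _ => ?_⟩
    simp only [Pi.zero_apply, abs_zero]
    positivity
  obtain ⟨u, huK, hmin⟩ := hKc.exists_isMinOn ⟨0, h0K⟩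
    (continuous_localFunctional (by linarith : 0 ≤ p) (by linarith : 0 ≤ q) a f B).continuousOn
  have hu := (hKmem u).1 huK
  have hJ : localFunctional p q a f B u ≤ 0 := by
    refine (hmin h0K).trans_eq ?_
    simp [localFunctional, (by linarith : p ≠ 0), (by linarith : q ≠ 0)]
  refine ⟨u, hu.1, hJ, fun x₀ hx₀ => Lop_eq_of_isLocalMin hp hq hx₀ ?_⟩
  have hsmall : ∀ᶠ t : ℝ in 𝓝 0, |t| < 1 := by
    filter_upwards [Metric.ball_mem_nhds (0 : ℝ) one_pos] with t ht
    simpa using ht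
  filter_upwards [hsmall] with t ht
  rw [zero_smul, add_zero]
  refine hmin ((hKmem _).2 ⟨fun x hx => ?_, fun x _ => ?_⟩)
  · have : x ≠ x₀ := fun h => hx (h ▸ hx₀)
    simp [hu.1 x hx, this]
  · have h1 := hbound u hu.1 hJ x
    have h2 : |t * (Pi.single x₀ 1 : ZN N → ℝ) x| ≤ |t| := by
      rw [abs_mul, Pi.single_apply]
      split_ifs <;> simp
    have h3 := abs_add_le (u x) (t * (Pi.single x₀ 1 : ZN N → ℝ) x)
    simp only [Pi.add_apply, Pi.smul_apply, smul_eq_mul]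
    linarith

lemma tsum_le_of_tendsto {α ι : Type*} {l : Filter α} [l.NeBot] {F : α → ι → ℝ≥0∞}
    {G : ι → ℝ≥0∞} {C : ℝ≥0∞} (h : ∀ i, Tendsto (fun k => F k i) l (𝓝 (G i)))
    (hC : ∀ k, ∑' i, F k i ≤ C) : ∑' i, G i ≤ C := by
  rw [ENNReal.tsum_eq_iSup_sum]
  exact iSup_le fun s => le_of_tendsto (tendsto_finsetSum s fun i _ => h i)
    (Eventually.of_forall fun k => (ENNReal.sum_le_tsum s).trans (hC k))

lemma vsum_le_of_tendsto {α : Type*} {l : Filter α} [l.NeBot] {s : ℝ} (hs : 0 ≤ s)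
    {u : α → ZN N → ℝ} {v : ZN N → ℝ} (h : Tendsto u l (𝓝 v)) {C : ℝ≥0∞}
    (hC : ∀ k, vsum s (u k) ≤ C) : vsum s v ≤ C := by
  refine tsum_le_of_tendsto (l := l) (fun x => ?_) hC
  exact ENNReal.tendsto_ofReal (((tendsto_pi_nhds.1 h x).abs).rpow_const (Or.inr hs))

lemma gradModular_le_of_tendsto {α : Type*} {l : Filter α} [l.NeBot] {p q : ℝ} (hp : 0 ≤ p)
    (hq : 0 ≤ q) (a : ZN N → ℝ) {u : α → ZN N → ℝ} {v : ZN N → ℝ} (h : Tendsto u l (𝓝 v))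
    {C : ℝ≥0∞} (hC : ∀ k, gradModular p q a (u k) ≤ C) : gradModular p q a v ≤ C := by
  simp only [gradModular, eInt,
    ENNReal.div_le_iff_le_mul (Or.inl two_ne_zero) (Or.inl ENNReal.ofNat_ne_top)] at hC ⊢
  refine tsum_le_of_tendsto (l := l) (fun z => ?_) hC
  split_ifs
  · have hd : Tendsto (fun k => |grad (u k) z.1 z.2|) l (𝓝 |grad v z.1 z.2|) :=
      ((tendsto_pi_nhds.1 h z.2).sub (tendsto_pi_nhds.1 h z.1)).abs
    exact ENNReal.tendsto_ofReal ((hd.rpow_const (Or.inr hp)).add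
      ((hd.rpow_const (Or.inr hq)).const_mul _))
  · exact tendsto_const_nhds

end Existence

/-- existence and uniqueness part (existence) of a solution to the double phase
problem `L u = f` on the lattice `ℤ^N` with datum `f ∈ ℓ^r`, `1/r + 1/p* ≥ 1`. -/
theorem statement0 {N : ℕ} (hN : 2 ≤ N) (p q : ℝ) (hp : 1 < p) (hpN : p < (N : ℝ))
    (hpq : p < q) (a : ZN N → ℝ) (ha : ∀ x, 0 ≤ a x)
    (pstar : ℝ) (hpstar : pstar = (N : ℝ) * p / ((N : ℝ) - p))
    (r : ℝ) (hr1 : 1 ≤ r) (hr : 1 / r + 1 / pstar ≥ 1)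
    (f : ZN N → ℝ) (hf : vsum r f < ⊤) :
    ∃ u : ZN N → ℝ, vsum pstar u < ⊤ ∧ gradModular p q a u < ⊤ ∧
      ∀ x₀ : ZN N, Lop p q a u x₀ = f x₀ := by
  have hp0 : 0 < p := by linarith
  have hq : 1 < q := hp.trans hpq
  have hNp : 0 < (N : ℝ) - p := by linarith
  have hps : 1 < pstar := by
    rw [hpstar, lt_div_iff₀ hNp]
    nlinarith
  have hconj := Real.HolderConjugate.conjExponent hps
  have hrs : r ≤ pstar.conjExponent := by
    have h1 := hconj.inv_add_inv_eq_one
    rw [← inv_le_inv₀ hconj.symm.pos (by linarith)]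
    rw [one_div, one_div] at hr
    linarith
  obtain ⟨C, hC, hfC⟩ := exists_forall_Lp_norm_le (by linarith) hrs hf
  obtain ⟨R, hR, hbound⟩ :=
    exists_bound_of_localFunctional_nonpos hN hp hpN hpq ha hpstar hconj hC hfC
  have hsol : ∀ B : Finset (ZN N), ∃ u : ZN N → ℝ, (∀ x ∉ B, u x = 0) ∧
      localFunctional p q a f B u ≤ 0 ∧ ∀ x ∈ B, Lop p q a u x = f x := fun B =>
    exists_solution_on_finset hp hq (M := R ^ pstar⁻¹) (by positivity) B
      fun u hu hJ => abs_le_of_vsum_le hconj.pos hR (hbound B u hu hJ).1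
  choose u hu0 huJ hueq using hsol
  have hub := fun B => hbound B (u B) (hu0 B) (huJ B)
  have hKc : IsCompact (Set.pi Set.univ fun _ : ZN N => Set.Icc (-R ^ pstar⁻¹) (R ^ pstar⁻¹)) :=
    isCompact_univ_pi fun _ => isCompact_Icc
  obtain ⟨v, -, hv⟩ := hKc.ultrafilter_le_nhds' ((Ultrafilter.of atTop).map u)
    (Ultrafilter.mem_map.2 (Filter.univ_mem' fun B x _ =>
      abs_le.1 (abs_le_of_vsum_le hconj.pos hR (hub B).1 x)))
  set l : Filter (Finset (ZN N)) := ↑(Ultrafilter.of (atTop : Filter (Finset (ZN N))))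
  have hlim : Tendsto u l (𝓝 v) := hv
  refine ⟨v,
    (vsum_le_of_tendsto hconj.nonneg hlim fun B => (hub B).1).trans_lt ENNReal.ofReal_lt_top,
    (gradModular_le_of_tendsto hp0.le (hp0.trans hpq).le a hlim fun B => (hub B).2).trans_lt
      ENNReal.ofReal_lt_top, fun x₀ => ?_⟩
  have hL : Tendsto (fun B => Lop p q a (u B) x₀) l (𝓝 (Lop p q a v x₀)) :=
    ((continuous_Lop hp hq a x₀).tendsto v).comp hlim
  refine tendsto_nhds_unique hL (tendsto_const_nhds.congr' ?_)
  refine Ultrafilter.of_le (atTop : Filter (Finset (ZN N))) ?_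
  filter_upwards [eventually_ge_atTop {x₀}] with B hB
  exact (hueq B x₀ (hB (Finset.mem_singleton_self x₀))).symm
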